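/- Let G act by isometries on an ℝ-tree T, and let S ⊂ G be a finitely generated subsemigroup acting non-trivially on T such that the minimal subtree invariant under the group ⟨S⟩ generated by S is not a line. Let I be an arc contained in the axis of a hyperbolic element h ∈ S. Then there exists a finitely generated subsemigroup S' ⊂ S such that ⟨S'⟩ = ⟨S⟩ and every element g ∈ S' ∖ {1} is hyperbolic in T, its axis contains I, and g translates in the same direction as h on I. -/

import Mathlib

/-!
Formalization of definitions from V. Guirardel,
"Core and intersection number for group actions on trees".
-/

open Set Metric Filter Function Topology
open scoped ENNReal Pointwise

noncomputable section

namespace Guirardel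

/-- The metric segment `[x,y]`: the set of points lying metrically between `x` and `y`.
In an `ℝ`-tree this is the image of the geodesic from `x` to `y`. -/
def seg {T : Type*} [MetricSpace T] (x y : T) : Set T :=
  {p : T | dist x p + dist p y = dist x y}

/-- The open segment `]x,y[`. -/
def openSeg {T : Type*} [MetricSpace T] (x y : T) : Set T :=
  seg x y \ {x, y}

/-- A subset of an `ℝ`-tree is convex (i.e. a subtree when nonempty) if it contains the
segment between any two of its points. -/
def TreeConvex {T : Type*} [MetricSpace T] (S : Set T) : Prop :=
  ∀ x ∈ S, ∀ y ∈ S, seg x y ⊆ S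

/-- An `ℝ`-tree: any two points are joined by a geodesic, and any two injective paths
with the same endpoints have the same image (uniqueness of arcs). -/
structure IsRTree (T : Type*) [MetricSpace T] : Prop where
  exists_geod : ∀ x y : T, ∃ f : ℝ → T, f 0 = x ∧ f (dist x y) = y ∧
    ∀ s ∈ Icc (0 : ℝ) (dist x y), ∀ t ∈ Icc (0 : ℝ) (dist x y),
      dist (f s) (f t) = |s - t|
  arc_unique : ∀ (x y : T) (γ₁ γ₂ : Path x y),
    Function.Injective γ₁ → Function.Injective γ₂ →
      Set.range γ₁ = Set.range γ₂

/-- A direction based at `x`: a connected component of the complement of `x`. -/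
def IsDirectionAt {T : Type*} [MetricSpace T] (δ : Set T) (x : T) : Prop :=
  ∃ y : T, y ≠ x ∧ δ = connectedComponentIn {x}ᶜ y

/-- A direction in a tree. -/
def IsDirection {T : Type*} [MetricSpace T] (δ : Set T) : Prop :=
  ∃ x : T, IsDirectionAt δ x

/-- A branch point: a point with at least three directions. -/
def IsBranchPoint {T : Type*} [MetricSpace T] (x : T) : Prop :=
  ∃ δ₁ δ₂ δ₃ : Set T, IsDirectionAt δ₁ x ∧ IsDirectionAt δ₂ x ∧ IsDirectionAt δ₃ x ∧
    δ₁ ≠ δ₂ ∧ δ₁ ≠ δ₃ ∧ δ₂ ≠ δ₃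

/-- A quadrant in `T₁ × T₂`: a product of two directions. -/
def IsQuadrant {T₁ T₂ : Type*} [MetricSpace T₁] [MetricSpace T₂]
    (Q : Set (T₁ × T₂)) : Prop :=
  ∃ (δ₁ : Set T₁) (δ₂ : Set T₂), IsDirection δ₁ ∧ IsDirection δ₂ ∧ Q = δ₁ ×ˢ δ₂

/-- A quadrant is heavy if (for every choice of base point, which does not matter) there
is a sequence of orbit points inside it whose two coordinates go to infinity. -/
def Heavy (G : Type*) {T₁ T₂ : Type*} [Group G] [MetricSpace T₁] [MetricSpace T₂]
    [MulAction G T₁] [MulAction G T₂] (Q : Set (T₁ × T₂)) : Prop :=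
  ∀ p : T₁ × T₂, ∃ γ : ℕ → G,
    (∀ k, ((γ k • p.1 : T₁), (γ k • p.2 : T₂)) ∈ Q) ∧
    Tendsto (fun k => dist (γ k • p.1) p.1) atTop atTop ∧
    Tendsto (fun k => dist (γ k • p.2) p.2) atTop atTop

/-- The core of `T₁ × T₂`: the complement of the union of all light (i.e. non-heavy)
quadrants; equivalently the set of points all of whose quadrants are heavy. -/
def Core (G T₁ T₂ : Type*) [Group G] [MetricSpace T₁] [MetricSpace T₂]
    [MulAction G T₁] [MulAction G T₂] : Set (T₁ × T₂) :=
  {z : T₁ × T₂ | ∀ Q : Set (T₁ × T₂), IsQuadrant Q → z ∈ Q → Heavy G Q}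

/-- A subset of `T₁ × T₂` has convex fibers if its horizontal and vertical fibers
are convex. -/
def ConvexFibers {T₁ T₂ : Type*} [MetricSpace T₁] [MetricSpace T₂]
    (E : Set (T₁ × T₂)) : Prop :=
  (∀ x₁ : T₁, TreeConvex {y₂ : T₂ | (x₁, y₂) ∈ E}) ∧
  (∀ x₂ : T₂, TreeConvex {y₁ : T₁ | (y₁, x₂) ∈ E})

/-- The action of `G` on `T` is by isometries. -/
def IsometricAction (G T : Type*) [MetricSpace T] [SMul G T] : Prop :=
  ∀ (g : G) (x y : T), dist (g • x) (g • y) = dist x y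

/-- `g` is elliptic: it fixes a point of `T`. -/
def Elliptic {G : Type*} (T : Type*) [SMul G T] (g : G) : Prop :=
  ∃ x : T, g • x = x

/-- `g` is hyperbolic: it fixes no point of `T`. -/
def Hyperbolic {G : Type*} (T : Type*) [SMul G T] (g : G) : Prop :=
  ∀ x : T, g • x ≠ x

/-- Translation length of `g` on `T`. -/
def translationLength {G : Type*} (T : Type*) [MetricSpace T] [SMul G T] (g : G) : ℝ :=
  ⨅ x : T, dist x (g • x)

/-- The axis (characteristic set) of `g`: points minimizing displacement. -/
def axisSet {G : Type*} (T : Type*) [MetricSpace T] [SMul G T] (g : G) : Set T :=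
  {x : T | ∀ y : T, dist x (g • x) ≤ dist y (g • y)}

/-- The action is non-trivial: some element is hyperbolic. -/
def NontrivialAction (G T : Type*) [SMul G T] : Prop :=
  ∃ g : G, ∀ x : T, g • x ≠ x

/-- The action is free: only the identity fixes a point. -/
def FreeAction (G T : Type*) [Group G] [MulAction G T] : Prop :=
  ∀ g : G, g ≠ 1 → ∀ x : T, g • x ≠ x

/-- The action is minimal: no proper nonempty invariant subtree. -/
def MinimalAction (G T : Type*) [MetricSpace T] [SMul G T] : Prop :=
  ∀ S : Set T, S.Nonempty → TreeConvex S → (∀ g : G, ∀ x ∈ S, g • x ∈ S) → S = univ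

/-- The minimal subtree for the subset `H` of `G`: the intersection of all nonempty
invariant subtrees. -/
def minSubtreeOf {G : Type*} (H : Set G) (T : Type*) [MetricSpace T] [SMul G T] : Set T :=
  ⋂₀ {S : Set T | S.Nonempty ∧ TreeConvex S ∧ ∀ g ∈ H, ∀ x ∈ S, g • x ∈ S}

/-- The minimal subtree of the `G`-action. -/
def minSubtree (G T : Type*) [MetricSpace T] [SMul G T] : Set T :=
  minSubtreeOf (univ : Set G) T

/-- A line in `T`: the image of an isometric embedding of `ℝ`. -/
def IsLine {T : Type*} [MetricSpace T] (L : Set T) : Prop :=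
  ∃ f : ℝ → T, (∀ s t : ℝ, dist (f s) (f t) = |s - t|) ∧ L = range f

/-- A ray in `T`: the image of an isometric embedding of `[0,∞)`. -/
def IsRay {T : Type*} [MetricSpace T] (R : Set T) : Prop :=
  ∃ f : ℝ → T, (∀ s ∈ Ici (0 : ℝ), ∀ t ∈ Ici (0 : ℝ), dist (f s) (f t) = |s - t|) ∧
    R = f '' Ici 0

/-- Two rays (or subsets) define the same end when they are at finite Hausdorff distance. -/
def SameEnd {T : Type*} [MetricSpace T] (R R' : Set T) : Prop :=
  EMetric.hausdorffEdist R R' ≠ ⊤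

/-- The action of `G` fixes an end of `T`. -/
def GFixedEnd (G T : Type*) [MetricSpace T] [SMul G T] : Prop :=
  ∃ R : Set T, IsRay R ∧ ∀ g : G, SameEnd ((fun x => g • x) '' R) R

/-- The action of `G` has an invariant line. -/
def GInvariantLine (G T : Type*) [MetricSpace T] [SMul G T] : Prop :=
  ∃ L : Set T, IsLine L ∧ ∀ g : G, (fun x => g • x) '' L = L

/-- The action is irreducible: no invariant line and no fixed end. -/
def IrreducibleAction (G T : Type*) [MetricSpace T] [SMul G T] : Prop :=
  ¬ GInvariantLine G T ∧ ¬ GFixedEnd G T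

/-- The action is dihedral: there is an invariant line on which some element acts as a
reflection (i.e. with non-constant displacement along the line). -/
def DihedralAction (G T : Type*) [MetricSpace T] [SMul G T] : Prop :=
  ∃ L : Set T, IsLine L ∧ (∀ g : G, (fun x => g • x) '' L = L) ∧
    ∃ g : G, ∃ x ∈ L, ∃ y ∈ L, dist x (g • x) ≠ dist y (g • y)

/-- `A` is a positive semi-axis of `g`: a ray contained in the axis of `g` and mapped
into itself by `g`. -/
def PosSemiAxis {G : Type*} (T : Type*) [MetricSpace T] [SMul G T] (g : G) (A : Set T) :
    Prop :=
  IsRay A ∧ A ⊆ axisSet T g ∧ (fun x => g • x) '' A ⊆ A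

/-- `g` translates towards the end determined by the ray `R`:
`g` is hyperbolic and has a positive semi-axis defining the same end as `R`. -/
def TranslatesToward {G : Type*} (T : Type*) [MetricSpace T] [SMul G T] (g : G)
    (R : Set T) : Prop :=
  Hyperbolic T g ∧ ∃ A : Set T, PosSemiAxis T g A ∧ SameEnd A R

/-- The end `ω_T(g)` of the hyperbolic element `g` lies in the set of ends of `δ`:
some positive semi-axis of `g` is contained in `δ`. -/
def EndInSubtree {G : Type*} (T : Type*) [MetricSpace T] [SMul G T] (g : G)
    (δ : Set T) : Prop :=
  ∃ A : Set T, PosSemiAxis T g A ∧ A ⊆ δ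

/-- A map between `ℝ`-trees preserves alignment if the image of a point between `y`
and `z` lies between the images of `y` and `z`. -/
def AlignPreserving {T T' : Type*} [MetricSpace T] [MetricSpace T'] (f : T → T') : Prop :=
  ∀ x y z : T, x ∈ seg y z → f x ∈ seg (f y) (f z)

/-- `f : T → T'` witnesses that `T` is a refinement of `T'`: it is an equivariant
continuous surjection preserving alignment. -/
def IsRefinementMap (G : Type*) {T T' : Type*} [Group G] [MetricSpace T] [MetricSpace T']
    [MulAction G T] [MulAction G T'] (f : T → T') : Prop :=
  Continuous f ∧ Surjective f ∧ AlignPreserving f ∧ ∀ (g : G) (x : T), f (g • x) = g • f x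

/-- The length functions of the two actions are homothetic. -/
def HomotheticLengths (G T₁ T₂ : Type*) [MetricSpace T₁] [MetricSpace T₂] [SMul G T₁]
    [SMul G T₂] : Prop :=
  ∃ c : ℝ, 0 < c ∧ ∀ g : G, translationLength T₁ g = c * translationLength T₂ g

/-- A bundled `ℝ`-tree with an isometric action of `G`. -/
structure GTree (G : Type*) [Group G] where
  carrier : Type
  [ms : MetricSpace carrier]
  [ma : MulAction G carrier]
  isom : ∀ (g : G) (x y : carrier), dist (g • x) (g • y) = dist x y
  tree : IsRTree carrier

attribute [instance] GTree.ms GTree.ma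

/-- A simplicial structure on an `ℝ`-tree: a vertex set containing all branch points,
meeting every segment in a finite set, and discrete. -/
def IsSimplicialStructure {T : Type*} [MetricSpace T] (V : Set T) : Prop :=
  (∀ x : T, IsBranchPoint x → x ∈ V) ∧
  (∀ x y : T, (seg x y ∩ V).Finite) ∧
  (∀ v ∈ V, ∃ ε > 0, ∀ w ∈ V, dist v w < ε → w = v)

/-- Two vertices of a simplicial tree are adjacent (span an edge). -/
def Adjacent {T : Type*} [MetricSpace T] (V : Set T) (v w : T) : Prop :=
  v ∈ V ∧ w ∈ V ∧ v ≠ w ∧ seg v w ∩ V = {v, w}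

/-- A bundled simplicial `G`-tree. -/
structure SimplicialGTree (G : Type*) [Group G] extends GTree G where
  V : Set carrier
  simp : IsSimplicialStructure V
  inv : ∀ g : G, (fun x => g • x) '' V = V

/-- `T₁` and `T₂` are refinements of a common non-trivial simplicial action of `G`. -/
def RefineCommonSimplicial (G T₁ T₂ : Type*) [Group G] [MetricSpace T₁] [MetricSpace T₂]
    [MulAction G T₁] [MulAction G T₂] : Prop :=
  ∃ T' : SimplicialGTree G, NontrivialAction G T'.carrier ∧
    (∃ f₁ : T₁ → T'.carrier, IsRefinementMap G f₁) ∧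
    (∃ f₂ : T₂ → T'.carrier, IsRefinementMap G f₂)

/-- Two directions face each other: their union is the whole tree. -/
def FacingDirections {T : Type*} [MetricSpace T] (δ δ' : Set T) : Prop :=
  δ ∪ δ' = univ

/-- There is a twice-light rectangle with (opposite) base corners `x` and `x'`:
two light quadrants based at `x` and `x'` facing each other. -/
def IsTwiceLightRect (G : Type*) {T₁ T₂ : Type*} [Group G] [MetricSpace T₁]
    [MetricSpace T₂] [MulAction G T₁] [MulAction G T₂] (x x' : T₁ × T₂) : Prop :=
  ∃ (δ₁ : Set T₁) (δ₂ : Set T₂) (δ₁' : Set T₁) (δ₂' : Set T₂),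
    IsDirectionAt δ₁ x.1 ∧ IsDirectionAt δ₂ x.2 ∧
    IsDirectionAt δ₁' x'.1 ∧ IsDirectionAt δ₂' x'.2 ∧
    x.1 ≠ x'.1 ∧ x.2 ≠ x'.2 ∧
    FacingDirections δ₁ δ₁' ∧ FacingDirections δ₂ δ₂' ∧
    ¬ Heavy G (δ₁ ×ˢ δ₂) ∧ ¬ Heavy G (δ₁' ×ˢ δ₂')

/-- The open rectangle with opposite corners `x, x'`. -/
def openRect {T₁ T₂ : Type*} [MetricSpace T₁] [MetricSpace T₂] (x x' : T₁ × T₂) :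
    Set (T₁ × T₂) :=
  openSeg x.1 x'.1 ×ˢ openSeg x.2 x'.2

/-- A maximal twice-light rectangle. -/
def IsMaxTwiceLightRect (G : Type*) {T₁ T₂ : Type*} [Group G] [MetricSpace T₁]
    [MetricSpace T₂] [MulAction G T₁] [MulAction G T₂] (x x' : T₁ × T₂) : Prop :=
  IsTwiceLightRect G x x' ∧ ∀ y y' : T₁ × T₂, IsTwiceLightRect G y y' →
    openRect x x' ⊆ openRect y y' → openRect x x' = openRect y y'

/-- The straight diagonal of a rectangle joining the two opposite corners `p` and `q`. -/
def mainDiag {T₁ T₂ : Type*} [MetricSpace T₁] [MetricSpace T₂] (p q : T₁ × T₂) :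
    Set (T₁ × T₂) :=
  {z : T₁ × T₂ | z.1 ∈ seg p.1 q.1 ∧ z.2 ∈ seg p.2 q.2 ∧
    dist p.1 z.1 * dist p.2 q.2 = dist p.2 z.2 * dist p.1 q.1}

/-- The augmented core: the union of the core and of the main diagonals of the maximal
twice-light rectangles (the diagonals joining the two opposite corners lying in the core). -/
def AugCore (G T₁ T₂ : Type*) [Group G] [MetricSpace T₁] [MetricSpace T₂]
    [MulAction G T₁] [MulAction G T₂] : Set (T₁ × T₂) :=
  Core G T₁ T₂ ∪
    {z : T₁ × T₂ | ∃ x x' p q : T₁ × T₂, IsMaxTwiceLightRect G x x' ∧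
      p ∈ Core G T₁ T₂ ∧ q ∈ Core G T₁ T₂ ∧
      ({p.1, q.1} : Set T₁) = {x.1, x'.1} ∧ ({p.2, q.2} : Set T₂) = {x.2, x'.2} ∧
      p.1 ≠ q.1 ∧ p.2 ≠ q.2 ∧ z ∈ mainDiag p q}

/-- There exists an equivariant (strong) deformation retraction of `T₁ × T₂` onto `C`. -/
def EquivDeformRetract (G : Type*) {T₁ T₂ : Type*} [Group G] [MetricSpace T₁]
    [MetricSpace T₂] [MulAction G T₁] [MulAction G T₂] (C : Set (T₁ × T₂)) : Prop :=
  ∃ H : ℝ → T₁ × T₂ → T₁ × T₂,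
    Continuous (fun p : ℝ × (T₁ × T₂) => H p.1 p.2) ∧
    (∀ z : T₁ × T₂, H 0 z = z) ∧
    (∀ z : T₁ × T₂, H 1 z ∈ C) ∧
    (∀ t : ℝ, ∀ z ∈ C, H t z = z) ∧
    (∀ (t : ℝ) (g : G) (z : T₁ × T₂), H t (g • z) = g • H t z)

/-- The `ℓ²` product distance on `T₁ × T₂`. -/
def dist2 {T₁ T₂ : Type*} [MetricSpace T₁] [MetricSpace T₂] (p q : T₁ × T₂) : ℝ :=
  Real.sqrt (dist p.1 q.1 ^ 2 + dist p.2 q.2 ^ 2)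

/-- The length of a path `c : [0,1] → T₁ × T₂`, measured with the `ℓ²` product metric. -/
def pathLen2 {T₁ T₂ : Type*} [MetricSpace T₁] [MetricSpace T₂] (c : ℝ → T₁ × T₂) :
    ℝ≥0∞ :=
  ⨆ (n : ℕ) (u : Fin (n + 1) → ℝ) (_ : Monotone u) (_ : ∀ i, u i ∈ Icc (0 : ℝ) 1),
    ∑ i : Fin n, ENNReal.ofReal (dist2 (c (u i.castSucc)) (c (u i.succ)))

/-- The path metric induced on a subset `C ⊆ T₁ × T₂` by the `ℓ²` product metric. -/
def pathDistOn {T₁ T₂ : Type*} [MetricSpace T₁] [MetricSpace T₂] (C : Set (T₁ × T₂))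
    (x y : C) : ℝ :=
  (⨅ (c : ℝ → T₁ × T₂) (_ : ContinuousOn c (Icc (0 : ℝ) 1))
      (_ : MapsTo c (Icc (0 : ℝ) 1) C) (_ : c 0 = (x : T₁ × T₂))
      (_ : c 1 = (y : T₁ × T₂)), pathLen2 c).toReal

/-- A distance function makes a set a CAT(0) space: it is a metric, geodesic, and the
CN-inequality of Bruhat–Tits holds (comparison triangles are at least as thick). -/
structure IsCAT0Dist {X : Type*} (d : X → X → ℝ) : Prop where
  refl : ∀ x, d x x = 0
  symm : ∀ x y, d x y = d y x
  triangle : ∀ x y z, d x z ≤ d x y + d y z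
  eq_of_dist_eq_zero : ∀ x y, d x y = 0 → x = y
  geodesic : ∀ x y, ∃ f : ℝ → X, f 0 = x ∧ f (d x y) = y ∧
    ∀ s ∈ Icc (0 : ℝ) (d x y), ∀ t ∈ Icc (0 : ℝ) (d x y), d (f s) (f t) = |s - t|
  cn : ∀ x y z m, d y m = d y z / 2 → d m z = d y z / 2 →
    d x m ^ 2 ≤ (d x y ^ 2 + d x z ^ 2) / 2 - d y z ^ 2 / 4

/-- A 2-cell of the core of a product of two simplicial trees: a rectangle which is a
product of two edges and is contained in the core. -/
def IsCoreCell (G : Type*) {T₁ T₂ : Type*} [Group G] [MetricSpace T₁] [MetricSpace T₂]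
    [MulAction G T₁] [MulAction G T₂] (V₁ : Set T₁) (V₂ : Set T₂)
    (R : Set (T₁ × T₂)) : Prop :=
  ∃ v₁ w₁ v₂ w₂, Adjacent V₁ v₁ w₁ ∧ Adjacent V₂ v₂ w₂ ∧
    R = seg v₁ w₁ ×ˢ seg v₂ w₂ ∧ R ⊆ Core G T₁ T₂


lemma seg_symm {T : Type*} [MetricSpace T] {x y p : T} (h : p ∈ seg x y) : p ∈ seg y x := by
  have h' : dist x p + dist p y = dist x y := h
  change dist y p + dist p x = dist y x
  rw [dist_comm y p, dist_comm p x, dist_comm y x]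
  linarith

lemma seg_trans {T : Type*} [MetricSpace T] {x y p q : T} (hp : p ∈ seg x y)
    (hq : q ∈ seg p y) : q ∈ seg x y ∧ p ∈ seg x q := by
  have h1 : dist x p + dist p y = dist x y := hp
  have h2 : dist p q + dist q y = dist p y := hq
  have h3 := dist_triangle x p q
  have h4 := dist_triangle x q y
  constructor
  · change dist x q + dist q y = dist x y
    linarith
  · change dist x p + dist p q = dist x q
    linarith

/-- `f` is isometric on the interval `[a, b]`. -/
def GeodOn {T : Type*} [MetricSpace T] (f : ℝ → T) (a b : ℝ) : Prop :=
  ∀ s ∈ Icc a b, ∀ t ∈ Icc a b, dist (f s) (f t) = |s - t|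

section Segments

variable {T : Type*} [MetricSpace T]

lemma geodOn_of_le {f : ℝ → T} {a b : ℝ}
    (h : ∀ s t, a ≤ s → s ≤ t → t ≤ b → dist (f s) (f t) = t - s) : GeodOn f a b := by
  intro s hs t ht
  rcases le_total s t with hst | hst
  · rw [h s t hs.1 hst ht.2, abs_sub_comm, abs_of_nonneg (by linarith)]
  · rw [dist_comm, h t s ht.1 hst hs.2, abs_of_nonneg (by linarith)]

lemma GeodOn.dist_of_le {f : ℝ → T} {a b s t : ℝ} (h : GeodOn f a b) (hs : a ≤ s)
    (hst : s ≤ t) (ht : t ≤ b) : dist (f s) (f t) = t - s := by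
  rw [h s ⟨hs, hst.trans ht⟩ t ⟨hs.trans hst, ht⟩, abs_sub_comm, abs_of_nonneg (by linarith)]

lemma dist_le_of_geodOn {f : ℝ → T} {a b c : ℝ} (h1 : GeodOn f a b)
    (h2 : GeodOn f b c) {s t : ℝ} (hs : a ≤ s) (hst : s ≤ t) (ht : t ≤ c) :
    dist (f s) (f t) ≤ t - s := by
  rcases le_total t b with htb | htb
  · exact (h1.dist_of_le hs hst htb).le
  rcases le_total b s with hsb | hsb
  · exact (h2.dist_of_le hsb hst ht).le
  have e1 := h1.dist_of_le hs hsb le_rfl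
  have e2 := h2.dist_of_le le_rfl htb ht
  linarith [dist_triangle (f s) (f b) (f t)]

lemma geodOn_glue {f : ℝ → T} {a b c : ℝ} (hab : a ≤ b) (hbc : b ≤ c) (h1 : GeodOn f a b)
    (h2 : GeodOn f b c) (h : f b ∈ seg (f a) (f c)) : GeodOn f a c := by
  refine geodOn_of_le fun s t hs hst ht => ?_
  have h' : dist (f a) (f b) + dist (f b) (f c) = dist (f a) (f c) := h
  rw [h1.dist_of_le le_rfl hab le_rfl, h2.dist_of_le le_rfl hbc le_rfl] at h'
  have e0 := dist_le_of_geodOn h1 h2 hs hst ht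
  have e1 := dist_le_of_geodOn h1 h2 le_rfl hs (hst.trans ht)
  have e2 := dist_le_of_geodOn h1 h2 (hs.trans hst) ht le_rfl
  linarith [dist_triangle4 (f a) (f s) (f t) (f c)]

lemma GeodOn.mem_seg {f : ℝ → T} {a b t : ℝ} (h : GeodOn f a b) (ht : t ∈ Icc a b) :
    f t ∈ seg (f a) (f b) := by
  change dist _ _ + dist _ _ = dist _ _
  rw [h.dist_of_le le_rfl ht.1 ht.2, h.dist_of_le ht.1 ht.2 le_rfl,
    h.dist_of_le le_rfl (ht.1.trans ht.2) le_rfl]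
  ring

lemma GeodOn.continuousOn {f : ℝ → T} {a b : ℝ} (h : GeodOn f a b) :
    ContinuousOn f (Icc a b) := by
  refine (LipschitzOnWith.of_dist_le_mul (K := 1) fun s hs t ht => ?_).continuousOn
  rw [h s hs t ht, Real.dist_eq]
  simp

lemma GeodOn.injOn {f : ℝ → T} {a b : ℝ} (h : GeodOn f a b) : InjOn f (Icc a b) := by
  intro s hs t ht hst
  have := h s hs t ht
  rw [hst, dist_self] at this
  linarith [abs_eq_zero.1 this.symm]

end Segments

lemma exists_glue {T : Type*} [MetricSpace T] (hT : IsRTree T) (x y z : T) :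
    ∃ F : ℝ → T, F 0 = x ∧ F (dist x y) = y ∧ F (dist x y + dist y z) = z ∧
      GeodOn F 0 (dist x y) ∧ GeodOn F (dist x y) (dist x y + dist y z) := by
  obtain ⟨f, hf0, hf1, hf⟩ := hT.exists_geod x y
  obtain ⟨g, hg0, hg1, hg⟩ := hT.exists_geod y z
  have hxy : 0 ≤ dist x y := dist_nonneg
  have hl : ∀ t, t ≤ dist x y → (if t ≤ dist x y then f t else g (t - dist x y)) = f t :=
    fun t ht => if_pos ht
  have hr : ∀ t, dist x y ≤ t →
      (if t ≤ dist x y then f t else g (t - dist x y)) = g (t - dist x y) := by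
    intro t ht
    split_ifs with h
    · rw [le_antisymm h ht, hf1, sub_self, hg0]
    · rfl
  refine ⟨fun t => if t ≤ dist x y then f t else g (t - dist x y), ?_, ?_, ?_, ?_, ?_⟩
  · exact (hl _ hxy).trans hf0
  · exact (hl _ le_rfl).trans hf1
  · refine (hr _ (by linarith [dist_nonneg (x := y) (y := z)])).trans ?_
    rw [add_sub_cancel_left, hg1]
  · intro s hs t ht
    simp only [hl s hs.2, hl t ht.2]
    exact hf s hs t ht
  · intro s hs t ht
    simp only [hr s hs.1, hr t ht.1]
    rw [hg _ ⟨by linarith [hs.1], by linarith [hs.2]⟩ _ ⟨by linarith [ht.1], by linarith [ht.2]⟩]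
    congr 1
    ring

section Tree

variable {T : Type*} [MetricSpace T]

lemma exists_injective_path {f : ℝ → T} {L : ℝ} (hL : 0 < L)
    (hf : ContinuousOn f (Icc 0 L)) (hi : InjOn f (Icc 0 L)) :
    ∃ γ : Path (f 0) (f L), Function.Injective γ ∧ Set.range γ = f '' Icc 0 L := by
  have hmem : ∀ t : unitInterval, L * (t : ℝ) ∈ Icc 0 L := fun t =>
    ⟨mul_nonneg hL.le t.2.1, mul_le_of_le_one_right hL.le t.2.2⟩
  refine ⟨⟨⟨fun t : unitInterval => f (L * t), ?_⟩, by simp, by simp⟩, ?_, ?_⟩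
  · exact hf.comp_continuous (by fun_prop) hmem
  · intro s t hst
    have := hi (hmem s) (hmem t) hst
    exact Subtype.ext (mul_left_cancel₀ hL.ne' this)
  · ext p
    constructor
    · rintro ⟨t, rfl⟩
      exact ⟨_, hmem t, rfl⟩
    · rintro ⟨t, ht, rfl⟩
      refine ⟨⟨t / L, div_nonneg ht.1 hL.le, (div_le_one hL).2 ht.2⟩, ?_⟩
      change f (L * (t / L)) = f t
      rw [mul_div_cancel₀ _ hL.ne']

lemma arc_image_eq (hT : IsRTree T) {f g : ℝ → T} {L M : ℝ} (hL : 0 < L) (hM : 0 < M)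
    (hf : ContinuousOn f (Icc 0 L)) (hfi : InjOn f (Icc 0 L))
    (hg : ContinuousOn g (Icc 0 M)) (hgi : InjOn g (Icc 0 M))
    (h0 : f 0 = g 0) (h1 : f L = g M) : f '' Icc 0 L = g '' Icc 0 M := by
  obtain ⟨γ, hγ, hγr⟩ := exists_injective_path hL hf hfi
  obtain ⟨δ, hδ, hδr⟩ := exists_injective_path hM hg hgi
  rw [← hγr, ← hδr, hT.arc_unique _ _ γ (δ.cast h0 h1) hγ hδ]
  rfl

lemma seg_self (x : T) : seg x x = {x} := by
  ext p
  change dist x p + dist p x = dist x x ↔ p = x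
  rw [dist_self, dist_comm p x]
  constructor
  · intro h
    exact (dist_eq_zero.1 (by linarith)).symm
  · rintro rfl
    simp

lemma seg_eq_image (hT : IsRTree T) {f : ℝ → T} {a b : ℝ} (hab : a ≤ b)
    (hf : GeodOn f a b) : seg (f a) (f b) = f '' Icc a b := by
  refine Subset.antisymm (fun p hp => ?_) ?_
  · rcases hab.eq_or_lt with rfl | hlt
    · rw [seg_self] at hp
      exact ⟨a, ⟨le_rfl, le_rfl⟩, hp.symm⟩
    obtain ⟨F, F0, F1, F2, G1, G2⟩ := exists_glue hT (f a) p (f b)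
    have hF : GeodOn F 0 (dist (f a) p + dist p (f b)) := by
      refine geodOn_glue dist_nonneg (by linarith [dist_nonneg (x := p) (y := f b)]) G1 G2 ?_
      rw [F0, F1, F2]
      exact hp
    have hL : dist (f a) p + dist p (f b) = b - a :=
      Eq.trans hp (hf.dist_of_le le_rfl hab le_rfl)
    rw [hL] at hF F2
    have hg : GeodOn (fun t => f (a + t)) 0 (b - a) := by
      intro s hs t ht
      change dist (f (a + s)) (f (a + t)) = _
      rw [hf _ ⟨by linarith [hs.1], by linarith [hs.2]⟩ _
        ⟨by linarith [ht.1], by linarith [ht.2]⟩]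
      congr 1
      ring
    have himg := arc_image_eq hT (sub_pos.2 hlt) (sub_pos.2 hlt) hF.continuousOn hF.injOn
      hg.continuousOn hg.injOn (by simp [F0]) (by simp [F2])
    have hmem : p ∈ F '' Icc 0 (b - a) :=
      ⟨dist (f a) p, ⟨dist_nonneg, by linarith [dist_nonneg (x := p) (y := f b)]⟩, F1⟩
    rw [himg] at hmem
    obtain ⟨t, ht, rfl⟩ := hmem
    exact ⟨a + t, ⟨by linarith [ht.1], by linarith [ht.2]⟩, rfl⟩
  · rintro _ ⟨t, ht, rfl⟩
    exact hf.mem_seg ht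

lemma exists_seg_eq_image (hT : IsRTree T) (x y : T) :
    ∃ f : ℝ → T, f 0 = x ∧ f (dist x y) = y ∧ GeodOn f 0 (dist x y) ∧
      seg x y = f '' Icc 0 (dist x y) := by
  obtain ⟨f, hf0, hf1, hf⟩ := hT.exists_geod x y
  refine ⟨f, hf0, hf1, hf, ?_⟩
  have := seg_eq_image hT dist_nonneg hf
  rwa [hf0, hf1] at this

lemma mem_seg_of_dist_le (hT : IsRTree T) {x y p q : T} (hp : p ∈ seg x y) (hq : q ∈ seg x y)
    (h : dist x p ≤ dist x q) : p ∈ seg x q := by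
  obtain ⟨f, hf0, hf1, hf, hseg⟩ := exists_seg_eq_image hT x y
  rw [hseg] at hp hq
  obtain ⟨s, hs, rfl⟩ := hp
  obtain ⟨t, ht, rfl⟩ := hq
  have e1 := hf.dist_of_le le_rfl hs.1 hs.2
  have e2 := hf.dist_of_le le_rfl ht.1 ht.2
  rw [hf0] at e1 e2
  have hst : s ≤ t := by linarith
  change dist _ _ + dist _ _ = dist _ _
  rw [hf.dist_of_le hs.1 hst ht.2]
  linarith

lemma mem_seg_of_inter_subset (hT : IsRTree T) {x y z : T}
    (h : ∀ p ∈ seg x y, p ∈ seg y z → p = y) : y ∈ seg x z := by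
  rcases eq_or_ne x y with rfl | hxy
  · change dist x x + dist x z = dist x z
    simp
  rcases eq_or_ne x z with rfl | hxz
  · exact absurd (h x (by change dist x x + dist x y = dist x y; simp)
      (by change dist y x + dist x x = dist y x; simp)) hxy
  obtain ⟨F, F0, F1, F2, G1, G2⟩ := exists_glue hT x y z
  obtain ⟨f, hf0, hf1, hf, hseg⟩ := exists_seg_eq_image hT x z
  have hyz : 0 ≤ dist y z := dist_nonneg
  have hpos : 0 < dist x y := dist_pos.2 hxy
  have hcont : ContinuousOn F (Icc 0 (dist x y + dist y z)) := by
    refine (LipschitzOnWith.of_dist_le_mul (K := 1) fun s hs t ht => ?_).continuousOn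
    rw [Real.dist_eq, NNReal.coe_one, one_mul]
    rcases le_total s t with hst | hst
    · rw [abs_sub_comm, abs_of_nonneg (by linarith)]
      exact dist_le_of_geodOn G1 G2 hs.1 hst ht.2
    · rw [abs_of_nonneg (by linarith), dist_comm]
      exact dist_le_of_geodOn G1 G2 ht.1 hst hs.2
  have hinj' : ∀ s ∈ Icc 0 (dist x y + dist y z), ∀ t ∈ Icc 0 (dist x y + dist y z),
      s ≤ t → F s = F t → s = t := by
    intro s hs t ht hst heq
    rcases le_total t (dist x y) with htb | htb
    · exact G1.injOn ⟨hs.1, hst.trans htb⟩ ⟨ht.1, htb⟩ heq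
    rcases le_total (dist x y) s with hsb | hsb
    · exact G2.injOn ⟨hsb, hs.2⟩ ⟨htb, ht.2⟩ heq
    have m1 := G1.mem_seg (t := s) ⟨hs.1, hsb⟩
    have m2 := G2.mem_seg (t := t) ⟨htb, ht.2⟩
    rw [F0, F1] at m1
    rw [F1, F2, ← heq] at m2
    have e := h _ m1 m2
    have e1 : s = dist x y := G1.injOn ⟨hs.1, hsb⟩ ⟨hpos.le, le_rfl⟩ (e.trans F1.symm)
    have e2 : t = dist x y := G2.injOn ⟨htb, ht.2⟩ ⟨le_rfl, by linarith⟩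
      ((heq.symm.trans e).trans F1.symm)
    rw [e1, e2]
  have hinj : InjOn F (Icc 0 (dist x y + dist y z)) := by
    intro s hs t ht heq
    rcases le_total s t with hst | hst
    · exact hinj' s hs t ht hst heq
    · exact (hinj' t ht s hs hst heq.symm).symm
  have himg := arc_image_eq hT (by linarith) (dist_pos.2 hxz) hcont hinj hf.continuousOn hf.injOn
    (F0.trans hf0.symm) (F2.trans hf1.symm)
  rw [hseg, ← himg]
  exact ⟨dist x y, ⟨hpos.le, by linarith⟩, F1⟩

/-- Betweenness in an `ℝ`-tree is a local condition: two overlapping geodesics concatenate. -/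
lemma seg_extend (hT : IsRTree T) {x y z w : T} (hy : y ∈ seg x z) (hz : z ∈ seg y w)
    (hyz : y ≠ z) : y ∈ seg x w ∧ z ∈ seg x w := by
  have hd : 0 < dist y z := dist_pos.2 hyz
  have hy' : dist x y + dist y z = dist x z := hy
  have hz' : dist y z + dist z w = dist y w := hz
  have hmain : z ∈ seg x w := by
    refine mem_seg_of_inter_subset hT fun q hq hqw => ?_
    have hqw' : dist z q + dist q w = dist z w := hqw
    rcases le_total (dist z q) (dist z y) with hle | hle
    · have h1 : dist z q + dist q y = dist z y :=
        mem_seg_of_dist_le hT (seg_symm hq) (seg_symm hy) hle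
      have h2 := dist_triangle y q w
      rw [dist_comm y q] at h2
      rw [dist_comm z y] at h1
      have : dist z q = 0 := by linarith [dist_nonneg (x := z) (y := q)]
      exact (dist_eq_zero.1 this).symm
    · have h1 : dist z y + dist y q = dist z q :=
        mem_seg_of_dist_le hT (seg_symm hy) (seg_symm hq) hle
      have h2 := dist_triangle y q w
      rw [dist_comm z y] at h1
      linarith
  refine ⟨?_, hmain⟩
  have hz'' : dist x z + dist z w = dist x w := hmain
  change dist x y + dist y w = dist x w
  linarith

/-- Existence of the median point of a tripod. -/
lemma exists_median (hT : IsRTree T) (x y z : T) :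
    ∃ m, m ∈ seg x y ∧ m ∈ seg x z ∧ m ∈ seg y z := by
  obtain ⟨f, hf0, hf1, hf, hseg⟩ := exists_seg_eq_image hT x y
  have hcpt : IsCompact (seg x y) := by
    rw [hseg]
    exact isCompact_Icc.image_of_continuousOn hf.continuousOn
  have hcl : IsClosed (seg x z) := isClosed_eq (by fun_prop) (by fun_prop)
  have hx1 : x ∈ seg x y := by change dist x x + dist x y = dist x y; simp
  have hx2 : x ∈ seg x z := by change dist x x + dist x z = dist x z; simp
  obtain ⟨m, ⟨hm1, hm2⟩, hmax⟩ := (hcpt.inter_right hcl).exists_isMaxOn ⟨x, hx1, hx2⟩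
    (f := fun p => dist x p) (by fun_prop)
  refine ⟨m, hm1, hm2, mem_seg_of_inter_subset hT fun q hq hqz => ?_⟩
  have h1 := seg_trans hm1 (seg_symm hq)
  have h2 := seg_trans hm2 hqz
  have h3 : dist x q ≤ dist x m := hmax ⟨h1.1, h2.1⟩
  have h4 : dist x m + dist m q = dist x q := h1.2
  have : dist m q = 0 := by linarith [dist_nonneg (x := m) (y := q)]
  exact (dist_eq_zero.1 this).symm

lemma mem_connectedComponentIn_of_notMem_seg (hT : IsRTree T) {u v w : T}
    (h : u ∉ seg v w) : w ∈ connectedComponentIn {u}ᶜ v := by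
  obtain ⟨f, hf0, hf1, hf, hseg⟩ := exists_seg_eq_image hT v w
  have hv : v ∈ seg v w := by change dist v v + dist v w = dist v w; simp
  have hw : w ∈ seg v w := by change dist v w + dist w w = dist v w; simp
  have hpre : IsPreconnected (seg v w) := by
    rw [hseg]
    exact isPreconnected_Icc.image f hf.continuousOn
  exact hpre.subset_connectedComponentIn hv (fun p hp (hpu : p = u) => h (hpu ▸ hp)) hw

lemma notMem_connectedComponentIn_of_mem_seg (hT : IsRTree T) {u v w : T} (huv : u ≠ v)
    (h : u ∈ seg v w) : w ∉ connectedComponentIn {u}ᶜ v := by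
  intro hw
  have hpre : IsPreconnected (connectedComponentIn {u}ᶜ v) := isPreconnected_connectedComponentIn
  have hsub : connectedComponentIn {u}ᶜ v ⊆ {u}ᶜ := connectedComponentIn_subset _ _
  have hU : IsOpen {z : T | dist v z < dist v u + dist u z} :=
    isOpen_lt (by fun_prop) (by fun_prop)
  have hV : IsOpen {z : T | z ≠ u ∧ u ∈ seg v z} := by
    rw [Metric.isOpen_iff]
    rintro z ⟨hzu, hz⟩
    refine ⟨dist z u, dist_pos.2 hzu, fun z' hz' => ?_⟩
    rw [Metric.mem_ball] at hz'
    refine ⟨fun h0 => ?_, ?_⟩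
    · rw [h0, dist_comm] at hz'
      exact lt_irrefl _ hz'
    obtain ⟨m, hm1, hm2, hm3⟩ := exists_median hT u z z'
    have hmu : u ≠ m := by
      rintro rfl
      have h3 : dist z u + dist u z' = dist z z' := hm3
      rw [dist_comm z' z] at hz'
      linarith [dist_nonneg (x := u) (y := z')]
    have hum : u ∈ seg v m := (seg_trans hz hm1).2
    exact (seg_extend hT hum hm2 hmu).1
  have hv : v ∈ connectedComponentIn {u}ᶜ v :=
    mem_connectedComponentIn (fun h0 : v = u => huv h0.symm)
  obtain ⟨z, -, hz1, -, hz2⟩ := hpre _ _ hU hV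
    (fun z hz => by
      by_cases hzs : u ∈ seg v z
      · exact Or.inr ⟨hsub hz, hzs⟩
      · exact Or.inl (lt_of_le_of_ne (dist_triangle v u z) (Ne.symm hzs)))
    ⟨v, hv, by
      change dist v v < dist v u + dist u v
      rw [dist_self, dist_comm v u]
      linarith [dist_pos.2 huv]⟩
    ⟨w, hw, hsub hw, h⟩
  exact absurd hz2 (ne_of_gt hz1)

end Tree

/-- `F` is an isometric embedding of the real line. -/
def IsometricLine {T : Type*} [MetricSpace T] (F : ℝ → T) : Prop :=
  ∀ s t : ℝ, dist (F s) (F t) = |s - t|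

section Lines

variable {T : Type*} [MetricSpace T] {F F' : ℝ → T}

lemma IsometricLine.geodOn (hF : IsometricLine F) (a b : ℝ) : GeodOn F a b :=
  fun s _ t _ => hF s t

lemma IsometricLine.seg_subset_range (hT : IsRTree T) (hF : IsometricLine F) (s t : ℝ) :
    seg (F s) (F t) ⊆ range F := by
  intro p hp
  rcases le_total s t with h | h
  · rw [seg_eq_image hT h (hF.geodOn s t)] at hp
    exact image_subset_range _ _ hp
  · have hp := seg_symm hp
    rw [seg_eq_image hT h (hF.geodOn t s)] at hp
    exact image_subset_range _ _ hp

lemma IsometricLine.continuous (hF : IsometricLine F) : Continuous F := by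
  have : Isometry F := Isometry.of_dist_eq fun s t => by rw [hF, Real.dist_eq]
  exact this.continuous

/-- Nearest-point projection to a line in an `ℝ`-tree. -/
lemma IsometricLine.exists_projection (hT : IsRTree T) (hF : IsometricLine F) (y : T) :
    ∃ t₀, ∀ t, dist y (F t) = dist y (F t₀) + |t - t₀| := by
  have hcont : Continuous fun t => dist y (F t) := continuous_const.dist hF.continuous
  have hlim : Tendsto (fun t => dist y (F t)) (cocompact ℝ) atTop := by
    refine tendsto_atTop_mono (f := fun t : ℝ => ‖t‖ + -dist y (F 0)) (fun t => ?_)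
      (tendsto_atTop_add_const_right _ _ (tendsto_norm_cocompact_atTop (E := ℝ)))
    have h1 := dist_triangle_left (F t) (F 0) y
    rw [hF t 0, sub_zero] at h1
    rw [Real.norm_eq_abs]
    linarith
  obtain ⟨t₀, ht₀⟩ := hcont.exists_forall_le hlim
  refine ⟨t₀, fun t => ?_⟩
  have hmem : F t₀ ∈ seg y (F t) := by
    refine mem_seg_of_inter_subset hT fun q hq hqt => ?_
    obtain ⟨r, rfl⟩ := hF.seg_subset_range hT _ _ hqt
    have h1 : dist y (F r) + dist (F r) (F t₀) = dist y (F t₀) := hq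
    have h2 : dist y (F t₀) ≤ dist y (F r) := ht₀ r
    exact dist_eq_zero.1 (by linarith [dist_nonneg (x := F r) (y := F t₀)])
  have h3 : dist y (F t₀) + dist (F t₀) (F t) = dist y (F t) := hmem
  rw [← h3, hF, abs_sub_comm]

lemma IsometricLine.dist_of_projection_ne (hT : IsRTree T) (hF : IsometricLine F) {y z : T}
    {p q : ℝ} (hy : ∀ t, dist y (F t) = dist y (F p) + |t - p|)
    (hz : ∀ t, dist z (F t) = dist z (F q) + |t - q|) (hpq : p ≠ q) :
    dist y z = dist y (F p) + |p - q| + dist z (F q) := by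
  have h1 : F p ∈ seg y (F q) := by
    change _ + _ = _
    rw [hy q, hF, abs_sub_comm]
  have h2 : F q ∈ seg (F p) z := by
    refine seg_symm ?_
    change _ + _ = _
    rw [hz p, hF, abs_sub_comm]
  have hne : F p ≠ F q := by
    intro h
    have := hF p q
    rw [h, dist_self] at this
    exact hpq (sub_eq_zero.1 (abs_eq_zero.1 this.symm))
  have h3 : dist y (F q) + dist (F q) z = dist y z := (seg_extend hT h1 h2 hne).2
  rw [← h3, hy q, dist_comm (F q) z, abs_sub_comm]

/-- The positive end of `F'` either is the negative end of `F`, or lies on the positive side of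
some point of `F`, as measured by distances. -/
lemma IsometricLine.eventually_reversed_or_dist_eq (hT : IsRTree T) (hF : IsometricLine F)
    (hF' : IsometricLine F') :
    (∃ c R, ∀ r, R ≤ r → F' r = F (c - r)) ∨
      ∃ c R p, ∀ r, R ≤ r → ∀ t ≤ p, dist (F t) (F' r) = r - t + c := by
  by_cases H : ∃ R, ∀ r, R ≤ r → F' r ∈ range F
  · obtain ⟨R, hR⟩ := H
    have hφ : ∀ r, ∃ x, R ≤ r → F x = F' r := fun r => by
      by_cases hr : R ≤ r
      · obtain ⟨x, hx⟩ := hR r hr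
        exact ⟨x, fun _ => hx⟩
      · exact ⟨0, fun h => absurd h hr⟩
    choose φ hφ using hφ
    have hd : ∀ r, R ≤ r → ∀ s, R ≤ s → |φ r - φ s| = |r - s| := fun r hr s hs => by
      rw [← hF, ← hF', hφ r hr, hφ s hs]
    have h1 := hd (R + 1) (by linarith) R le_rfl
    rw [add_sub_cancel_left, abs_one] at h1
    rcases (abs_eq zero_le_one).1 h1 with h1 | h1
    · right
      refine ⟨φ R - R, R + 1, φ R, fun r hr t ht => ?_⟩
      have h2 := hd r (by linarith) R le_rfl
      have h3 := hd r (by linarith) (R + 1) (by linarith)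
      rw [abs_of_nonneg (a := r - R) (by linarith)] at h2
      rw [abs_of_nonneg (a := r - (R + 1)) (by linarith)] at h3
      rw [← hφ r (by linarith), hF, abs_sub_comm]
      rcases abs_eq (by linarith : 0 ≤ r - R) |>.1 h2 with h2 | h2
      · rw [abs_of_nonneg (by linarith)]
        linarith
      · rw [abs_of_nonpos (by linarith)] at h3
        linarith
    · left
      refine ⟨φ R + R, R + 1, fun r hr => ?_⟩
      have h2 := hd r (by linarith) R le_rfl
      have h3 := hd r (by linarith) (R + 1) (by linarith)
      rw [abs_of_nonneg (a := r - R) (by linarith)] at h2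
      rw [abs_of_nonneg (a := r - (R + 1)) (by linarith)] at h3
      rw [← hφ r (by linarith)]
      congr 1
      rcases abs_eq (by linarith : 0 ≤ r - R) |>.1 h2 with h2 | h2
      · rw [abs_of_nonneg (by linarith)] at h3
        linarith
      · linarith
  · right
    push Not at H
    obtain ⟨q, hq⟩ := hF'.exists_projection hT (F 0)
    obtain ⟨R, hqR, hR⟩ := H q
    obtain ⟨p, hp⟩ := hF.exists_projection hT (F' R)
    refine ⟨dist (F' R) (F p) + p - R, R, p, fun r hr t ht => ?_⟩
    have hne : F p ≠ F' R := fun h => hR ⟨p, h⟩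
    have h1 : F' R ∈ seg (F 0) (F' r) := by
      change _ + _ = _
      rw [hq R, hq r, hF', abs_of_nonneg (by linarith), abs_of_nonpos (by linarith),
        abs_of_nonneg (by linarith)]
      ring
    have h2 : ∀ t, F p ∈ seg (F t) (F' R) := fun t => by
      refine seg_symm ?_
      change _ + _ = _
      rw [hp t, hF, abs_sub_comm]
    have h3 : F' R ∈ seg (F p) (F' r) :=
      seg_symm (seg_trans (seg_symm h1) (seg_symm (h2 0))).2
    have h4 : dist (F t) (F' R) + dist (F' R) (F' r) = dist (F t) (F' r) :=
      (seg_extend hT (h2 t) h3 hne).2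
    rw [← h4, dist_comm (F t), hp t, hF', abs_of_nonpos (by linarith), abs_of_nonpos (by linarith)]
    ring

end Lines

section Isometries

variable {G T : Type*} [Group G] [MetricSpace T] [MulAction G T]

lemma smul_mem_seg (hiso : IsometricAction G T) (g : G) {x y p : T} (hp : p ∈ seg x y) :
    g • p ∈ seg (g • x) (g • y) := by
  change dist _ _ + dist _ _ = dist _ _
  rw [hiso, hiso, hiso]
  exact hp

lemma smul_mem_seg_of_mem_axisSet (hT : IsRTree T) (hiso : IsometricAction G T) {g : G} {x : T}
    (hx : x ∈ axisSet T g) (hg : g • x ≠ x) : g • x ∈ seg x (g • g • x) := by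
  obtain ⟨f, hf0, hf1, hf, -⟩ := exists_seg_eq_image hT x (g • x)
  have hl : 0 < dist x (g • x) := dist_pos.2 hg.symm
  have hm : f (dist x (g • x) / 2) ∈ seg x (g • x) := by
    have := hf.mem_seg (t := dist x (g • x) / 2) ⟨by linarith, by linarith⟩
    rwa [hf0, hf1] at this
  have hm1 := hf.dist_of_le (s := dist x (g • x) / 2) (by linarith) (by linarith) le_rfl
  rw [hf1] at hm1
  have hm0 := hf.dist_of_le (t := dist x (g • x) / 2) le_rfl (by linarith) (by linarith)
  rw [hf0] at hm0
  generalize f (dist x (g • x) / 2) = m at hm hm0 hm1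
  have hgm : g • m ∈ seg (g • x) (g • g • x) := smul_mem_seg hiso g hm
  have hd : dist (g • x) (g • m) = dist x m := hiso g x m
  have hmin : dist x (g • x) ≤ dist m (g • m) := hx m
  have htri := dist_triangle m (g • x) (g • m)
  have h1 : g • x ∈ seg m (g • m) := by
    change dist _ _ + dist _ _ = dist _ _
    linarith
  have hne : m ≠ g • x := by
    intro h
    rw [← h, dist_self] at hm1
    rw [← h] at hl
    linarith
  have h2 := (seg_extend hT hm h1 hne).2
  refine (seg_extend hT h2 hgm ?_).1
  intro h
  rw [← h, dist_self] at hd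
  linarith

lemma dist_pow_smul (hT : IsRTree T) (hiso : IsometricAction G T) {g : G} {x : T}
    (hx : g • x ∈ seg x (g • g • x)) (hg : g • x ≠ x) (n : ℕ) :
    dist x (g ^ n • x) = n * dist x (g • x) ∧ g ^ n • x ∈ seg x (g ^ (n + 1) • x) := by
  have hstep : ∀ n : ℕ, dist (g ^ n • x) (g ^ (n + 1) • x) = dist x (g • x) := fun n => by
    rw [pow_succ, mul_smul, hiso]
  induction n with
  | zero =>
    refine ⟨by simp, ?_⟩
    change _ + _ = _
    simp
  | succ n ih =>
    obtain ⟨ih1, ih2⟩ := ih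
    constructor
    · have h : _ + _ = dist _ _ := ih2
      rw [← h, ih1, hstep]
      push_cast
      ring
    · have h1 := smul_mem_seg hiso (g ^ n) hx
      simp only [← mul_smul, ← pow_succ, ← mul_assoc] at h1
      refine (seg_extend hT ih2 h1 fun h => hg ?_).2
      rw [← dist_eq_zero, hstep] at h
      exact (dist_eq_zero.1 h).symm

/-- An isometry moving `x` to `g • x` and then further along a geodesic is hyperbolic, with `x`
on its axis. -/
lemma hyperbolic_of_smul_mem_seg (hT : IsRTree T) (hiso : IsometricAction G T) {g : G} {x : T}
    (hx : g • x ∈ seg x (g • g • x)) (hg : g • x ≠ x) :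
    Hyperbolic T g ∧ x ∈ axisSet T g := by
  have hpos : 0 < dist x (g • x) := dist_pos.2 hg.symm
  have hmin : x ∈ axisSet T g := by
    intro y
    by_contra! hlt
    have hy : ∀ n : ℕ, dist y (g ^ n • y) ≤ n * dist y (g • y) := fun n => by
      induction n with
      | zero => simp
      | succ n ih =>
        have h1 := dist_triangle y (g ^ n • y) (g ^ (n + 1) • y)
        rw [pow_succ, mul_smul, hiso (g ^ n)] at h1
        rw [pow_succ, mul_smul]
        push_cast
        linarith
    obtain ⟨n, hn⟩ := exists_nat_gt (2 * dist x y / (dist x (g • x) - dist y (g • y)))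
    rw [div_lt_iff₀ (by linarith)] at hn
    have h1 := (dist_pow_smul hT hiso hx hg n).1
    have h2 := dist_triangle4 x y (g ^ n • y) (g ^ n • x)
    rw [hiso, dist_comm y x] at h2
    linarith [hy n]
  refine ⟨fun y hy => ?_, hmin⟩
  have h := hmin y
  rw [hy, dist_self] at h
  linarith

/-- The axis of a hyperbolic isometry, parametrised by arc length. -/
lemma exists_axis_line (hT : IsRTree T) (hiso : IsometricAction G T) {g : G} {x : T}
    (hx : g • x ∈ seg x (g • g • x)) (hg : g • x ≠ x) :
    ∃ F : ℝ → T, IsometricLine F ∧ F 0 = x ∧ ∀ t, g • F t = F (t + dist x (g • x)) := by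
  obtain ⟨f, hf0, hf1, hf, -⟩ := exists_seg_eq_image hT x (g • x)
  have hpos : 0 < dist x (g • x) := dist_pos.2 hg.symm
  have hpow := fun n => (dist_pow_smul hT hiso hx hg n).2
  generalize dist x (g • x) = l at *
  obtain ⟨F, hFdef⟩ : ∃ F : ℝ → T, ∀ t, F t = g ^ ⌊t / l⌋ • f (t - l * ⌊t / l⌋) :=
    ⟨_, fun _ => rfl⟩
  have hF0 : F 0 = x := by simp [hFdef, hf0]
  have htr : ∀ t, g • F t = F (t + l) := fun t => by
    have hfl : ⌊(t + l) / l⌋ = 1 + ⌊t / l⌋ := by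
      rw [add_div, div_self hpos.ne', Int.floor_add_one, add_comm]
    rw [hFdef, hFdef, hfl, zpow_one_add, mul_smul]
    congr 3
    push_cast
    ring
  have htrn : ∀ (n : ℕ) t, g ^ n • F t = F (t + n * l) := fun n => by
    induction n with
    | zero => simp
    | succ n ih =>
      intro t
      rw [pow_succ', mul_smul, ih, htr]
      congr 1
      push_cast
      ring
  have hFf : ∀ t ∈ Icc 0 l, F t = f t := by
    intro t ht
    rcases ht.2.eq_or_lt with rfl | hlt
    · rw [← zero_add t, ← htr, hF0, zero_add, hf1]
    · have : ⌊t / l⌋ = 0 := by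
        rw [Int.floor_eq_zero_iff]
        exact ⟨div_nonneg ht.1 hpos.le, (div_lt_one hpos).2 hlt⟩
      rw [hFdef, this]
      simp
  have hgeod : GeodOn F 0 l := fun s hs t ht => by rw [hFf s hs, hFf t ht, hf s hs t ht]
  have hFn : ∀ n : ℕ, F (n * l) = g ^ n • x := fun n => by
    rw [← hF0, htrn, zero_add]
  have hgeodn : ∀ n : ℕ, GeodOn F 0 (n * l) := fun n => by
    induction n with
    | zero =>
      intro s hs t ht
      have hs' := hs.2
      have ht' := ht.2
      rw [Nat.cast_zero, zero_mul] at hs' ht'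
      rw [le_antisymm hs' hs.1, le_antisymm ht' ht.1]
      simp
    | succ n ih =>
      have hnl : 0 ≤ n * l := by positivity
      refine geodOn_glue hnl (c := (n + 1 : ℕ) * l) (by push_cast; linarith) ih ?_ ?_
      · intro s hs t ht
        have hs' := hs.2
        have ht' := ht.2
        push_cast at hs' ht'
        have h1 := htrn n (s - n * l)
        have h2 := htrn n (t - n * l)
        rw [sub_add_cancel] at h1 h2
        rw [← h1, ← h2, hiso, hgeod _ ⟨by linarith [hs.1], by linarith⟩ _
          ⟨by linarith [ht.1], by linarith⟩]
        congr 1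
        ring
      · rw [hF0, hFn, hFn]
        exact hpow n
  refine ⟨F, fun s t => ?_, hF0, htr⟩
  obtain ⟨k, hk⟩ := exists_nat_gt (max (-s) (-t) / l)
  rw [div_lt_iff₀ hpos] at hk
  obtain ⟨n, hn⟩ := exists_nat_gt ((max s t + k * l) / l)
  rw [div_lt_iff₀ hpos] at hn
  have := le_max_left (-s) (-t)
  have := le_max_right (-s) (-t)
  have := le_max_left s t
  have := le_max_right s t
  rw [← hiso (g ^ k), htrn, htrn, hgeodn n _ ⟨by linarith, by linarith⟩ _
    ⟨by linarith, by linarith⟩]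
  congr 1
  ring

end Isometries

/-- `g` moves the segment from `a` to `b` coherently past itself: the points `a`, `b`, `g • a`,
`g • b` lie in this order on a geodesic. -/
def Advances {G T : Type*} [SMul G T] [MetricSpace T] (g : G) (a b : T) : Prop :=
  dist a (g • b) = 2 * dist a b + dist b (g • a)

section Advances

variable {G T : Type*} [Group G] [MetricSpace T] [MulAction G T] {a b : T}

lemma Advances.mul (hT : IsRTree T) (hiso : IsometricAction G T) (hab : a ≠ b) {g k : G}
    (hg : Advances g a b) (hk : Advances k a b) : Advances (g * k) a b := by
  unfold Advances at *
  have e1 := hiso g a b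
  have e2 := hiso g b (k • a)
  have e3 := hiso g a (k • b)
  have e4 := hiso g (k • a) (k • b)
  have e5 := hiso k a b
  have t1 := dist_triangle4 a b (g • a) (g • b)
  have t2 := dist_triangle (g • a) (g • b) (g • k • b)
  have t3 := dist_triangle4 (g • a) (g • b) (g • k • a) (g • k • b)
  have t4 := dist_triangle a (g • a) (g • b)
  have t5 := dist_triangle a b (g • a)
  have t6 := dist_triangle (g • b) (g • k • a) (g • k • b)
  have h1 : g • a ∈ seg a (g • b) := by
    change _ + _ = _
    linarith
  have h2 : g • b ∈ seg (g • a) (g • k • b) := by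
    change _ + _ = _
    linarith
  have hne : g • a ≠ g • b := fun h => hab (MulAction.injective g h)
  have h3 : dist a (g • b) + dist (g • b) (g • k • b) = dist a (g • k • b) :=
    (seg_extend hT h1 h2 hne).2
  have t7 := dist_triangle4 a b (g • k • a) (g • k • b)
  have t8 := dist_triangle4 b (g • a) (g • b) (g • k • a)
  rw [mul_smul, mul_smul]
  linarith

lemma Advances.hyperbolic (hT : IsRTree T) (hiso : IsometricAction G T) (hab : a ≠ b) {g : G}
    (hg : Advances g a b) : Hyperbolic T g ∧ seg a b ⊆ axisSet T g := by
  have hpos := dist_pos.2 hab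
  have hgg : dist a (g • g • b) = 3 * dist a b + 2 * dist b (g • a) := by
    have h2 : Advances (g * g) a b := hg.mul hT hiso hab hg
    unfold Advances at *
    rw [mul_smul, mul_smul] at h2
    have e1 := hiso g a b
    have e2 := hiso g b (g • a)
    have t2 := dist_triangle4 b (g • a) (g • b) (g • g • a)
    have e3 := hiso g a (g • b)
    have t1 := dist_triangle4 a b (g • a) (g • b)
    have h1 : g • a ∈ seg a (g • b) := by
      change _ + _ = _
      linarith [dist_triangle a b (g • a), dist_triangle a (g • a) (g • b)]
    have h3 : g • b ∈ seg (g • a) (g • g • b) := by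
      refine smul_mem_seg hiso g ?_
      change _ + _ = _
      linarith [dist_triangle a b (g • b), dist_triangle b (g • a) (g • b)]
    have h4 : dist a (g • b) + dist (g • b) (g • g • b) = dist a (g • g • b) :=
      (seg_extend hT h1 h3 fun h => hab (MulAction.injective g h)).2
    linarith [hiso g b (g • b), dist_triangle b (g • a) (g • b),
      dist_triangle a b (g • b)]
  have hx : ∀ x ∈ seg a b, Hyperbolic T g ∧ x ∈ axisSet T g := by
    intro x hx
    have hx' : dist a x + dist x b = dist a b := hx
    have e1 := hiso g a x
    have e2 := hiso g x (g • x)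
    have e3 := hiso g (g • x) (g • b)
    have e4 := hiso g x b
    have t1 := dist_triangle4 a x (g • g • x) (g • g • b)
    have t2 := dist_triangle4 x b (g • a) (g • x)
    have t3 := dist_triangle x (g • x) (g • g • x)
    have hlen : dist x (g • x) = dist a b + dist b (g • a) := by linarith
    refine hyperbolic_of_smul_mem_seg hT hiso ?_ fun h => ?_
    · change _ + _ = _
      linarith
    · rw [h, dist_self] at hlen
      linarith [dist_nonneg (x := b) (y := g • a)]
  refine ⟨(hx a ?_).1, fun x h => (hx x h).2⟩
  change _ + _ = _
  simp

lemma Advances.smul_mem_connectedComponentIn (hT : IsRTree T) (hab : a ≠ b) {g : G}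
    (hiso : IsometricAction G T) (hg : Advances g a b) :
    g • a ∈ connectedComponentIn {a}ᶜ b := by
  refine mem_connectedComponentIn_of_notMem_seg hT fun h => ?_
  have h' : dist b a + dist a (g • a) = dist b (g • a) := h
  have hg' : dist a (g • b) = 2 * dist a b + dist b (g • a) := hg
  linarith [dist_triangle a (g • a) (g • b), hiso g a b, dist_pos.2 hab, dist_comm a b]

lemma Advances.smul_notMem_connectedComponentIn (hT : IsRTree T) (hab : a ≠ b) {g : G}
    (hiso : IsometricAction G T) (hg : Advances g a b) :
    g • b ∉ connectedComponentIn {b}ᶜ a := by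
  refine notMem_connectedComponentIn_of_mem_seg hT hab.symm ?_
  change dist a b + dist b (g • b) = dist a (g • b)
  have hg' : dist a (g • b) = 2 * dist a b + dist b (g • a) := hg
  linarith [dist_triangle a b (g • b), hiso g a b, dist_triangle b (g • a) (g • b)]

end Advances

section Axis

lemma pow_smul_line {G T : Type*} [Group G] [MulAction G T] {F : ℝ → T} {h : G} {l : ℝ}
    (hF : ∀ t, h • F t = F (t + l)) (n : ℕ) (t : ℝ) :
    h ^ n • F t = F (t + n * l) := by
  induction n generalizing t with
  | zero => simp
  | succ n ih =>
    rw [pow_succ', mul_smul, ih, hF]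
    congr 1
    push_cast
    ring

variable {G T : Type*} [Group G] [MetricSpace T] [MulAction G T] {F : ℝ → T} {h : G} {l : ℝ}

/-- A line translated by `h` contains the whole axis of `h`. -/
lemma axisSet_subset_range (hT : IsRTree T) (hiso : IsometricAction G T) (hline : IsometricLine F)
    (hl : 0 < l) (hF : ∀ t, h • F t = F (t + l)) : axisSet T h ⊆ range F := by
  intro y hy
  obtain ⟨p, hp⟩ := hline.exists_projection hT y
  have hq : ∀ t, dist (h • y) (F t) = dist y (F (t - l)) := fun t => by
    rw [← hiso h y, hF, sub_add_cancel]
  have hq' : ∀ t, dist (h • y) (F t) = dist (h • y) (F (p + l)) + |t - (p + l)| := fun t => by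
    rw [hq, hq, hp, add_sub_cancel_right]
    congr 2
    ring
  have h1 := hline.dist_of_projection_ne hT hp hq' (by linarith)
  rw [hq, add_sub_cancel_right, show p - (p + l) = -l by ring, abs_neg, abs_of_pos hl] at h1
  have h2 := hy (F 0)
  rw [hF, hline, zero_add, zero_sub, abs_neg, abs_of_pos hl, h1] at h2
  have h3 : dist y (F p) = 0 := by linarith [dist_nonneg (x := y) (y := F p)]
  exact ⟨p, (dist_eq_zero.1 h3).symm⟩

lemma minSubtreeOf_eq_range (hT : IsRTree T) (hiso : IsometricAction G T)
    (hline : IsometricLine F) (hl : 0 < l) (hF : ∀ t, h • F t = F (t + l)) {H : Subgroup G}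
    (hH : h ∈ H) (hinv : ∀ g ∈ H, ∀ x ∈ range F, g • x ∈ range F) :
    minSubtreeOf (H : Set G) T = range F := by
  refine Subset.antisymm (sInter_subset_of_mem ⟨range_nonempty F, ?_, hinv⟩) ?_
  · rintro _ ⟨s, rfl⟩ _ ⟨t, rfl⟩
    exact hline.seg_subset_range hT s t
  refine subset_sInter ?_
  rintro X ⟨⟨y, hy⟩, hconv, hX⟩ _ ⟨t, rfl⟩
  obtain ⟨p, hp⟩ := hline.exists_projection hT y
  obtain ⟨n, hn⟩ := exists_nat_gt (|t - p| / l)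
  rw [div_lt_iff₀ hl] at hn
  have hpos : 0 < n * l := (abs_nonneg _).trans_lt hn
  have habs := abs_lt.1 hn
  have h1 : ∀ s, dist (h ^ n • y) (F s) = dist y (F p) + |s - (p + n * l)| := fun s => by
    rw [← sub_add_cancel s (n * l), ← pow_smul_line hF, hiso, hp]
    congr 2
    ring
  have h2 : ∀ s, dist ((h ^ n)⁻¹ • y) (F s) = dist y (F p) + |s - (p - n * l)| := fun s => by
    rw [← hiso (h ^ n), smul_inv_smul, pow_smul_line hF, hp]
    congr 2
    ring
  have h3 := hline.dist_of_projection_ne hT (fun s => by rw [h2 s, h2 (p - n * l)]; simp)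
    (fun s => by rw [h1 s, h1 (p + n * l)]; simp) (p := p - n * l) (q := p + n * l)
    (by linarith)
  refine hconv _ (hX _ (H.inv_mem (H.pow_mem hH n)) y hy) _ (hX _ (H.pow_mem hH n) y hy) ?_
  change _ + _ = _
  rw [h3, dist_comm (F t), h1, h2, h1, h2, abs_of_nonneg (a := t - (p - n * l)) (by linarith),
    abs_of_nonpos (a := t - (p + n * l)) (by linarith),
    abs_of_nonpos (a := p - n * l - (p + n * l)) (by linarith), sub_self, sub_self, abs_zero]
  ring

lemma smul_range_eq (hT : IsRTree T) (hiso : IsometricAction G T) (hline : IsometricLine F)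
    {g : G} {R R' : ℝ} (hpos : ∀ r, R ≤ r → g • F r ∈ range F)
    (hneg : ∀ r, r ≤ R' → g • F r ∈ range F) : g • range F = range F := by
  have hsub : ∀ t, ∃ s, F s = g • F t := by
    intro t
    obtain ⟨p, hp⟩ := hneg (min R' t) (min_le_left _ _)
    obtain ⟨q, hq⟩ := hpos (max R t) (le_max_left _ _)
    have h1 := (hline.geodOn (min R' t) (max R t)).mem_seg (t := t)
      ⟨min_le_right _ _, le_max_right _ _⟩
    have h2 := smul_mem_seg hiso g h1
    rw [← hp, ← hq] at h2
    exact hline.seg_subset_range hT p q h2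
  choose φ hφ using hsub
  have hd : ∀ s t, |φ s - φ t| = |s - t| := fun s t => by
    rw [← hline, ← hline s t, hφ, hφ, hiso]
  refine Subset.antisymm ?_ ?_
  · rintro _ ⟨_, ⟨t, rfl⟩, rfl⟩
    exact ⟨φ t, hφ t⟩
  · rintro _ ⟨y, rfl⟩
    have hsurj : φ (y - φ 0) = y ∨ φ (-(y - φ 0)) = y := by
      have h1 := hd (y - φ 0) 0
      have h2 := hd (-(y - φ 0)) 0
      have h3 := hd (y - φ 0) (-(y - φ 0))
      rw [sub_zero] at h1 h2
      rw [abs_neg] at h2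
      rw [sub_neg_eq_add] at h3
      rcases abs_eq_abs.1 h1 with h1 | h1
      · left
        linarith
      rcases abs_eq_abs.1 h2 with h2 | h2
      · right
        linarith
      · left
        have h4 : φ (y - φ 0) = φ (-(y - φ 0)) := by linarith
        rw [h4, sub_self, abs_zero] at h3
        have h5 := abs_eq_zero.1 h3.symm
        linarith
    rcases hsurj with hs | hs
    · exact ⟨F (y - φ 0), mem_range_self _, (hφ _).symm.trans (congrArg F hs)⟩
    · exact ⟨F (-(y - φ 0)), mem_range_self _, (hφ _).symm.trans (congrArg F hs)⟩

/-- Unless `s` sends the positive end of the axis of `h` to the negative one, some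
`h ^ n * s * h ^ n` advances any given segment of the axis. -/
lemma reversed_or_exists_advances (hT : IsRTree T) (hiso : IsometricAction G T)
    (hline : IsometricLine F) (hl : 0 < l) (hF : ∀ t, h • F t = F (t + l)) {α β : ℝ}
    (hαβ : α < β) (s : G) :
    (∃ c R, ∀ r, R ≤ r → s • F r = F (c - r)) ∨
      ∃ n : ℕ, Advances (h ^ n * s * h ^ n) (F α) (F β) := by
  have hline' : IsometricLine fun t => s • F t := fun x y => by rw [hiso, hline]
  refine (hline.eventually_reversed_or_dist_eq hT hline').imp id ?_
  rintro ⟨c, R, p, hd⟩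
  obtain ⟨n, hn⟩ := exists_nat_gt (max (R - α) (β - p) / l)
  rw [div_lt_iff₀ hl] at hn
  have m1 := le_max_left (R - α) (β - p)
  have m2 := le_max_right (R - α) (β - p)
  have key : ∀ x y, x ≤ β → α ≤ y →
      dist (F x) ((h ^ n * s * h ^ n) • F y) = y - x + 2 * (n * l) + c := fun x y hx hy => by
    rw [mul_smul, mul_smul, pow_smul_line hF, ← sub_add_cancel x (n * l), ← pow_smul_line hF,
      hiso, hd _ (by linarith) _ (by linarith)]
    ring
  refine ⟨n, ?_⟩
  unfold Advances
  rw [key _ _ hαβ.le hαβ.le, key _ _ le_rfl le_rfl, hline, abs_of_neg (by linarith)]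
  ring

end Axis

section Semigroup

variable {G T : Type*} [Group G] [MetricSpace T] [MulAction G T] {F : ℝ → T} {h : G} {l : ℝ}

/-- A semigroup whose group does not have a line as minimal subtree contains an element sending
the positive end of the axis of `h` outside the two ends of this axis, as soon as some element
exchanges these ends. -/
lemma exists_mem_forall_exists_smul_notMem (hT : IsRTree T) (hiso : IsometricAction G T)
    (hline : IsometricLine F) (hl : 0 < l) (hF : ∀ t, h • F t = F (t + l)) {S : Subsemigroup G}
    (hhS : h ∈ S) (hS : ¬ IsLine (minSubtreeOf (↑(Subgroup.closure (S : Set G)) : Set G) T))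
    {s : G} (hs : s ∈ S) {c R : ℝ} (hrev : ∀ r, R ≤ r → s • F r = F (c - r)) :
    ∃ t ∈ S, ∀ R', ∃ r, R' ≤ r ∧ t • F r ∉ range F := by
  by_contra! H
  refine hS ⟨F, hline, minSubtreeOf_eq_range hT hiso hline hl hF
    (Subgroup.subset_closure hhS) ?_⟩
  have hstab : ∀ t ∈ S, t • range F = range F := by
    intro t ht
    obtain ⟨R₁, h₁⟩ := H t ht
    obtain ⟨R₂, h₂⟩ := H (t * s) (S.mul_mem ht hs)
    refine smul_range_eq hT hiso hline h₁ (R' := c - max R R₂) fun r hr => ?_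
    have hR : max R R₂ ≤ c - r := by linarith
    have h₃ := h₂ (c - r) ((le_max_right _ _).trans hR)
    rwa [mul_smul, hrev _ ((le_max_left _ _).trans hR), sub_sub_cancel] at h₃
  have hle : Subgroup.closure (S : Set G) ≤ MulAction.stabilizer G (range F) :=
    (Subgroup.closure_le _).2 hstab
  intro g hg x hx
  have hg' : g • range F = range F := hle hg
  rw [← hg']
  exact smul_mem_smul_set hx

lemma le_closure_advances (hT : IsRTree T) (hiso : IsometricAction G T)
    (hline : IsometricLine F) (hl : 0 < l) (hF : ∀ t, h • F t = F (t + l)) {S : Subsemigroup G}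
    (hhS : h ∈ S) (hS : ¬ IsLine (minSubtreeOf (↑(Subgroup.closure (S : Set G)) : Set G) T))
    {α β : ℝ} (hαβ : α < β) :
    (S : Set G) ⊆ Subgroup.closure {g : G | g ∈ S ∧ Advances g (F α) (F β)} := by
  set K := Subgroup.closure {g : G | g ∈ S ∧ Advances g (F α) (F β)}
  have hpowS : ∀ n : ℕ, h ^ (n + 1) ∈ S := fun n => by
    induction n with
    | zero => simpa using hhS
    | succ n ih =>
      rw [pow_succ]
      exact S.mul_mem ih hhS
  have hhK : h ∈ K := by
    obtain ⟨n, hn⟩ := exists_nat_gt ((β - α) / l)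
    rw [div_lt_iff₀ hl] at hn
    have hpow : ∀ m : ℕ, n ≤ m → h ^ (m + 1) ∈ K := fun m hm => by
      refine Subgroup.subset_closure ⟨hpowS m, ?_⟩
      have hml : (n : ℝ) * l ≤ m * l := by gcongr
      unfold Advances
      rw [pow_smul_line hF, pow_smul_line hF, hline, hline, hline]
      push_cast
      rw [abs_of_nonpos (by linarith), abs_of_nonpos (by linarith), abs_of_nonpos (by linarith)]
      ring
    have h1 := K.mul_mem (K.inv_mem (hpow n le_rfl)) (hpow (n + 1) (Nat.le_succ n))
    rwa [pow_succ h (n + 1), inv_mul_cancel_left] at h1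
  have hconj : ∀ s ∈ S, ∀ n : ℕ, h ^ n * s * h ^ n ∈ S := fun s hs n => by
    rcases n with _ | n
    · simpa using hs
    · exact S.mul_mem (S.mul_mem (hpowS n) hs) (hpowS n)
  have hgood : ∀ s ∈ S, (∃ c R, ∀ r, R ≤ r → s • F r = F (c - r)) ∨ s ∈ K := fun s hs => by
    refine (reversed_or_exists_advances hT hiso hline hl hF hαβ s).imp id ?_
    rintro ⟨n, hn⟩
    have h1 : h ^ n * s * h ^ n ∈ K := Subgroup.subset_closure ⟨hconj s hs n, hn⟩
    rwa [K.mul_mem_cancel_right (K.pow_mem hhK n),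
      K.mul_mem_cancel_left (K.pow_mem hhK n)] at h1
  intro s hs
  rcases hgood s hs with ⟨c, R, hrev⟩ | hsK
  · obtain ⟨t, ht, hout⟩ := exists_mem_forall_exists_smul_notMem hT hiso hline hl hF hhS hS hs hrev
    have htK : t ∈ K := by
      rcases hgood t ht with ⟨c', R', hrev'⟩ | htK
      · obtain ⟨r, hr, hn⟩ := hout R'
        exact absurd ⟨_, (hrev' r hr).symm⟩ hn
      · exact htK
    have hstK : s * t ∈ K := by
      rcases hgood (s * t) (S.mul_mem hs ht) with ⟨c', R', hrev'⟩ | hstK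
      · obtain ⟨r, hr, hn⟩ := hout (max R' (R - c + c'))
        have hr1 := (le_max_left _ _).trans hr
        have hr2 := (le_max_right _ _).trans hr
        refine absurd ⟨r + c - c', ?_⟩ hn
        have h1 := hrev' r hr1
        have h2 := hrev (r + c - c') (by linarith)
        rw [show c - (r + c - c') = c' - r by ring, ← h1, mul_smul] at h2
        exact MulAction.injective s h2
      · exact hstK
    exact (K.mul_mem_cancel_right htK).1 hstK
  · exact hsK

lemma exists_finset_subset_mem_closure {G : Type*} [Group G] {A : Set G} {g : G}
    (hg : g ∈ Subgroup.closure A) :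
    ∃ B : Finset G, (B : Set G) ⊆ A ∧ g ∈ Subgroup.closure (B : Set G) := by
  classical
  induction hg using Subgroup.closure_induction with
  | mem x hx => exact ⟨{x}, by simpa using hx, Subgroup.subset_closure (by simp)⟩
  | one => exact ⟨∅, by simp, one_mem _⟩
  | mul x y _ _ hx hy =>
    obtain ⟨B, hBA, hB⟩ := hx
    obtain ⟨C, hCA, hC⟩ := hy
    refine ⟨B ∪ C, by simpa using ⟨hBA, hCA⟩, mul_mem ?_ ?_⟩
    · exact Subgroup.closure_mono (by simp) hB
    · exact Subgroup.closure_mono (by simp) hC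
  | inv x _ hx =>
    obtain ⟨B, hBA, hB⟩ := hx
    exact ⟨B, hBA, inv_mem hB⟩

lemma exists_fg_subsemigroup_advances (hT : IsRTree T) (hiso : IsometricAction G T) {a b : T}
    (hab : a ≠ b) {S : Subsemigroup G}
    (hfg : ∃ A : Finset G, Subsemigroup.closure (A : Set G) = S)
    (hS : (S : Set G) ⊆ Subgroup.closure {g : G | g ∈ S ∧ Advances g a b}) :
    ∃ S' : Subsemigroup G, S' ≤ S ∧
      (∃ A' : Finset G, Subsemigroup.closure (A' : Set G) = S') ∧
      Subgroup.closure (S' : Set G) = Subgroup.closure (S : Set G) ∧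
      ∀ g ∈ S', Advances g a b := by
  classical
  obtain ⟨A, rfl⟩ := hfg
  have hfin : ∀ s : G, ∃ B : Finset G, (s ∈ A → s ∈ Subgroup.closure (B : Set G)) ∧
      (B : Set G) ⊆ {g : G | g ∈ Subsemigroup.closure (A : Set G) ∧ Advances g a b} := by
    intro s
    by_cases hs : s ∈ A
    · obtain ⟨B, hBA, hB⟩ :=
        exists_finset_subset_mem_closure (hS (Subsemigroup.subset_closure hs))
      exact ⟨B, fun _ => hB, hBA⟩
    · exact ⟨∅, fun h => absurd h hs, by simp⟩
  choose B hB hBsub using hfin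
  have hsub : ((A.biUnion B : Finset G) : Set G) ⊆
      {g : G | g ∈ Subsemigroup.closure (A : Set G) ∧ Advances g a b} := by
    intro g hg
    obtain ⟨s, -, hs⟩ := Finset.mem_biUnion.1 hg
    exact hBsub s hs
  have hle : Subsemigroup.closure ((A.biUnion B : Finset G) : Set G) ≤
      Subsemigroup.closure (A : Set G) :=
    Subsemigroup.closure_le.2 fun g hg => (hsub hg).1
  refine ⟨_, hle, ⟨_, rfl⟩, ?_, fun g hg => ?_⟩
  · refine le_antisymm (Subgroup.closure_mono hle) ((Subgroup.closure_le _).2 ?_)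
    let K := Subgroup.closure
      (Subsemigroup.closure ((A.biUnion B : Finset G) : Set G) : Set G)
    change Subsemigroup.closure (A : Set G) ≤ K.toSubmonoid.toSubsemigroup
    refine Subsemigroup.closure_le.2 fun s hs => ?_
    refine Subgroup.closure_mono (fun g hg => ?_) (hB s hs)
    exact Subsemigroup.subset_closure (Finset.mem_biUnion.2 ⟨s, hs, hg⟩)
  · induction hg using Subsemigroup.closure_induction with
    | mem g hg => exact (hsub hg).2
    | mul g k _ _ hg hk => exact hg.mul hT hiso hab hk

end Semigroup

/-- Lemma 1.4: a finitely generated semigroup `S` acting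
non-trivially, whose generated group has a non-linear minimal subtree, contains a
finitely generated subsemigroup `S'` generating the same group, all of whose non-trivial
elements are hyperbolic with axis containing `I = [u,v]`, translating in the same
direction as `h` on `I`. -/
theorem semigroup_coherent_hyperbolics
    {G T : Type*} [Group G] [MetricSpace T] [MulAction G T]
    (hT : IsRTree T) (hiso : IsometricAction G T)
    (S : Subsemigroup G) (hSfg : ∃ A : Finset G, Subsemigroup.closure (A : Set G) = S)
    (hSnontriv : ∃ s ∈ S, Hyperbolic T s)
    (hnotline : ¬ IsLine (minSubtreeOf (↑(Subgroup.closure (S : Set G)) : Set G) T))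
    (h : G) (hhS : h ∈ S) (hhyp : Hyperbolic T h)
    (u v : T) (huv : u ≠ v) (hI : seg u v ⊆ axisSet T h) :
    ∃ S' : Subsemigroup G, S' ≤ S ∧
      (∃ A' : Finset G, Subsemigroup.closure (A' : Set G) = S') ∧
      Subgroup.closure (S' : Set G) = Subgroup.closure (S : Set G) ∧
      ∀ g ∈ S', g ≠ 1 → Hyperbolic T g ∧ seg u v ⊆ axisSet T g ∧
        (g • u ∈ connectedComponentIn {u}ᶜ v ↔ h • u ∈ connectedComponentIn {u}ᶜ v) := by
  have hu : h • u ∈ seg u (h • h • u) := by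
    refine smul_mem_seg_of_mem_axisSet hT hiso (hI ?_) (hhyp u)
    change _ + _ = _
    simp
  obtain ⟨F, hline, hF0, hF⟩ := exists_axis_line hT hiso hu (hhyp u)
  have hl : 0 < dist u (h • u) := dist_pos.2 (hhyp u).symm
  generalize dist u (h • u) = l at hF hl
  obtain ⟨d, hFd⟩ := axisSet_subset_range hT hiso hline hl hF (hI (show v ∈ seg u v by
    change _ + _ = _
    simp))
  have hhu : h • u = F l := by rw [← hF0, hF, zero_add]
  rcases lt_trichotomy d 0 with hd | rfl | hd
  · have hdir : h • u ∉ connectedComponentIn {u}ᶜ v := by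
      refine notMem_connectedComponentIn_of_mem_seg hT huv ?_
      rw [hhu, ← hFd, ← hF0]
      exact (hline.geodOn d l).mem_seg ⟨hd.le, hl.le⟩
    have hclo := le_closure_advances hT hiso hline hl hF hhS hnotline hd
    rw [hF0, hFd] at hclo
    obtain ⟨S', hS'S, hfg, hgen, hadv⟩ :=
      exists_fg_subsemigroup_advances hT hiso huv.symm hSfg hclo
    refine ⟨S', hS'S, hfg, hgen, fun g hg _ => ?_⟩
    obtain ⟨h1, h2⟩ := (hadv g hg).hyperbolic hT hiso huv.symm
    exact ⟨h1, fun x hx => h2 (seg_symm hx), iff_of_false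
      ((hadv g hg).smul_notMem_connectedComponentIn hT huv.symm hiso) hdir⟩
  · exact absurd (hF0.symm.trans hFd) huv
  · have hdir : h • u ∈ connectedComponentIn {u}ᶜ v := by
      refine mem_connectedComponentIn_of_notMem_seg hT fun hmem => ?_
      have hmem' : dist v u + dist u (h • u) = dist v (h • u) := hmem
      rw [hhu, ← hFd, ← hF0, hline, hline, hline, abs_of_nonneg (by linarith),
        abs_of_nonpos (by linarith)] at hmem'
      rcases abs_cases (d - l) with h1 | h1 <;> linarith
    have hclo := le_closure_advances hT hiso hline hl hF hhS hnotline hd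
    rw [hF0, hFd] at hclo
    obtain ⟨S', hS'S, hfg, hgen, hadv⟩ :=
      exists_fg_subsemigroup_advances hT hiso huv hSfg hclo
    refine ⟨S', hS'S, hfg, hgen, fun g hg _ => ?_⟩
    obtain ⟨h1, h2⟩ := (hadv g hg).hyperbolic hT hiso huv
    exact ⟨h1, h2, iff_of_true
      ((hadv g hg).smul_mem_connectedComponentIn hT huv hiso) hdir⟩

end Guirardel
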